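/- arXiv:2310.00899 — 6 statements merged into one kernel-verified Lean document; each statement's English description precedes it below -/
import Mathlib

section
/- Let G be a finite abelian group admitting a generating set of size d, and let k ≥ d + 1 be an integer. Then the number of k-tuples (g₁, …, g_k) ∈ G^k whose entries do NOT generate G is at most d · 2^{d−k} · |G|^k, as an inequality of real numbers. Equivalently, the probability that k independent uniform samples from G fail to generate G is at most d · 2^{d−k}. -/
theorem sum_primesBelow_inv_sq_le (M : ℕ) :
    ∑ p ∈ Nat.primesBelow (2 * M + 3), (1 / (p : ℝ) ^ 2) ≤ 1 / 2 - 1 / (4 * ((M : ℝ) + 1)) := by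
  induction M with
  | zero =>
    have h : Nat.primesBelow 3 = {2} := by decide
    norm_num [h]
  | succ M ih =>
    have hne : ¬ (2 * M + 3 + 1).Prime := fun h => by
      have := h.eq_one_or_self_of_dvd 2 ⟨M + 2, by ring⟩
      omega
    have hstep : ∑ p ∈ Nat.primesBelow (2 * (M + 1) + 3), (1 / (p : ℝ) ^ 2) ≤
        ∑ p ∈ Nat.primesBelow (2 * M + 3), (1 / (p : ℝ) ^ 2) + 1 / (2 * (M : ℝ) + 3) ^ 2 := by
      rw [show 2 * (M + 1) + 3 = 2 * M + 3 + 1 + 1 by ring, Nat.primesBelow_succ, if_neg hne,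
        Nat.primesBelow_succ]
      split_ifs
      · rw [Finset.sum_insert (Nat.notMem_primesBelow _)]
        push_cast
        linarith
      · have : (0 : ℝ) ≤ 1 / (2 * (M : ℝ) + 3) ^ 2 := by positivity
        linarith
    have hbd : 1 / (2 * (M : ℝ) + 3) ^ 2 ≤ 1 / (4 * ((M : ℝ) + 1)) - 1 / (4 * ((M : ℝ) + 2)) := by
      rw [div_sub_div _ _ (by positivity) (by positivity), div_le_div_iff₀ (by positivity)
        (by positivity)]
      nlinarith [(Nat.cast_nonneg M : (0 : ℝ) ≤ M)]
    push_cast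
    rw [show (M : ℝ) + 1 + 1 = M + 2 by ring]
    linarith

/-- The homomorphisms to `ℤ/p` sending `s i` to `1` and all later `s j` to `0`. -/
def normalizedHoms {G : Type*} [CommGroup G] {d : ℕ} (s : Fin d → G) (p : ℕ) (i : Fin d) :
    Set (G →* Multiplicative (ZMod p)) :=
  {χ | χ (s i) = Multiplicative.ofAdd 1 ∧ ∀ j, i < j → χ (s j) = 1}

theorem isSimpleGroup_quotient_of_isCoatom {G : Type*} [Group G] {M : Subgroup G} [M.Normal]
    (hM : IsCoatom M) : IsSimpleGroup (G ⧸ M) where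
  toNontrivial := QuotientGroup.nontrivial_iff.2 hM.1
  eq_bot_or_eq_top_of_normal H _ := by
    have hsurj := QuotientGroup.mk'_surjective M
    rcases hM.le_iff.1 (QuotientGroup.le_comap_mk' M H) with h | h
    · exact Or.inr (Subgroup.comap_injective hsurj (h.trans (Subgroup.comap_top _).symm))
    · refine Or.inl (Subgroup.comap_injective hsurj (h.trans ?_))
      rw [MonoidHom.comap_bot, QuotientGroup.ker_mk']

theorem exists_surjective_hom_of_ne_top {G : Type*} [CommGroup G] [Finite G] {T : Subgroup G}
    (hT : T ≠ ⊤) : ∃ p : ℕ, p.Prime ∧ ∃ χ : G →* Multiplicative (ZMod p),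
      Function.Surjective χ ∧ T ≤ χ.ker := by
  obtain ⟨M, hM, hTM⟩ := (eq_top_or_exists_le_coatom T).resolve_left hT
  have : IsSimpleGroup (G ⧸ M) := isSimpleGroup_quotient_of_isCoatom hM
  have hp : (Nat.card (G ⧸ M)).Prime := IsSimpleGroup.prime_card
  let e := (zmodCyclicMulEquiv (inferInstance : IsCyclic (G ⧸ M))).symm
  refine ⟨_, hp, e.toMonoidHom.comp (QuotientGroup.mk' M),
    e.surjective.comp (QuotientGroup.mk'_surjective M), fun x hx => ?_⟩
  have h1 : (QuotientGroup.mk' M) x = 1 := (QuotientGroup.eq_one_iff x).2 (hTM hx)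
  rw [MonoidHom.mem_ker, MonoidHom.comp_apply, h1, map_one]

theorem surjective_of_mem_normalizedHoms {G : Type*} [CommGroup G] {d : ℕ} {s : Fin d → G}
    {p : ℕ} {i : Fin d} {χ : G →* Multiplicative (ZMod p)} (hχ : χ ∈ normalizedHoms s p i) :
    Function.Surjective χ := fun y => by
  obtain ⟨n, hn⟩ := ZMod.intCast_surjective y.toAdd
  refine ⟨s i ^ n, ?_⟩
  rw [map_zpow, hχ.1, ← ofAdd_zsmul]
  simp [hn]

theorem exists_normalizedHom_of_ne_top {G : Type*} [CommGroup G] [Finite G] {d : ℕ}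
    {s : Fin d → G} (hs : Subgroup.closure (Set.range s) = ⊤) {T : Subgroup G} (hT : T ≠ ⊤) :
    ∃ p ∈ (Nat.card G).primeFactors, ∃ i, ∃ χ ∈ normalizedHoms s p i, T ≤ χ.ker := by
  classical
  obtain ⟨p, hp, χ, hsurj, hker⟩ := exists_surjective_hom_of_ne_top hT
  have : Fact p.Prime := ⟨hp⟩
  have hne : (Finset.univ.filter fun i => χ (s i) ≠ 1).Nonempty := by
    by_contra! h
    have h1 : ∀ i, χ (s i) = 1 := by simpa [Finset.filter_eq_empty_iff] using h
    have h2 : χ = 1 := MonoidHom.eq_of_eqOn_dense hs (by rintro _ ⟨i, rfl⟩; simp [h1])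
    obtain ⟨x, hx⟩ := hsurj (Multiplicative.ofAdd 1)
    rw [h2, MonoidHom.one_apply] at hx
    exact one_ne_zero (α := ZMod p) (congrArg Multiplicative.toAdd hx).symm
  set i := Finset.max' _ hne with hi
  have hi1 : χ (s i) ≠ 1 := (Finset.mem_filter.1 (Finset.max'_mem _ hne)).2
  have hi0 : (χ (s i)).toAdd ≠ 0 := fun h => hi1 (by simpa using h)
  let m : Multiplicative (ZMod p) →* Multiplicative (ZMod p) :=
    AddMonoidHom.toMultiplicative (AddMonoidHom.mulLeft ((χ (s i)).toAdd)⁻¹)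
  have hm : m.comp χ ∈ normalizedHoms s p i := by
    refine ⟨?_, fun j hj => ?_⟩
    · change Multiplicative.ofAdd (((χ (s i)).toAdd)⁻¹ * (χ (s i)).toAdd) = _
      rw [inv_mul_cancel₀ hi0]
    · have : χ (s j) = 1 := by
        by_contra h
        exact absurd (Finset.le_max' _ j (Finset.mem_filter.2 ⟨Finset.mem_univ _, h⟩))
          (not_le.2 hj)
      rw [MonoidHom.comp_apply, this, map_one]
  refine ⟨p, ?_, i, m.comp χ, hm, fun x hx => ?_⟩
  · refine Nat.mem_primeFactors.2 ⟨hp, ?_, Nat.card_pos.ne'⟩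
    simpa using Subgroup.card_dvd_of_surjective χ hsurj
  · rw [MonoidHom.mem_ker, MonoidHom.comp_apply, MonoidHom.mem_ker.1 (hker hx), map_one]

theorem ncard_normalizedHoms_le {G : Type*} [CommGroup G] {d : ℕ}
    {s : Fin d → G} (hs : Subgroup.closure (Set.range s) = ⊤) (p : ℕ) [NeZero p] (i : Fin d) :
    (normalizedHoms s p i).Finite ∧ (normalizedHoms s p i).ncard ≤ p ^ (i : ℕ) := by
  let f : normalizedHoms s p i → (Fin i → Multiplicative (ZMod p)) :=
    fun χ j => χ.1 (s ⟨j, j.2.trans i.2⟩)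
  have hf : Function.Injective f := by
    rintro ⟨χ, hχ⟩ ⟨ψ, hψ⟩ h
    refine Subtype.ext (MonoidHom.eq_of_eqOn_dense hs ?_)
    rintro _ ⟨j, rfl⟩
    rcases lt_trichotomy j i with hj | rfl | hj
    · exact congrFun h ⟨j, hj⟩
    · rw [hχ.1, hψ.1]
    · rw [hχ.2 j hj, hψ.2 j hj]
  have : Finite (Multiplicative (ZMod p)) := inferInstanceAs (Finite (ZMod p))
  refine ⟨Finite.of_injective f hf, ?_⟩
  have := Nat.card_le_card_of_injective f hf
  simpa [Nat.card_fun] using this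

/-- The `k`-tuples lying in the kernel of some member of `normalizedHoms s p i`. -/
def kernelTuples {G : Type*} [CommGroup G] {d : ℕ} (s : Fin d → G) (k p : ℕ) (i : Fin d) :
    Set (Fin k → G) :=
  {g | ∃ χ ∈ normalizedHoms s p i, ∀ j, χ (g j) = 1}

theorem ncard_kernelTuples_mul_le {G : Type*} [CommGroup G] [Finite G] {d : ℕ}
    {s : Fin d → G} (hs : Subgroup.closure (Set.range s) = ⊤) (k p : ℕ) [NeZero p] (i : Fin d) :
    (kernelTuples s k p i).ncard * p ^ k ≤ p ^ (i : ℕ) * Nat.card G ^ k := by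
  obtain ⟨hfin, hcard⟩ := ncard_normalizedHoms_le hs p i
  have hker : ∀ χ ∈ normalizedHoms s p i,
      {g : Fin k → G | ∀ j, χ (g j) = 1}.ncard * p ^ k = Nat.card G ^ k := by
    intro χ hχ
    have h1 : {g : Fin k → G | ∀ j, χ (g j) = 1}.ncard = Nat.card χ.ker ^ k := by
      have e : {g : Fin k → G | ∀ j, χ (g j) = 1} ≃ (Fin k → χ.ker) :=
        Equiv.subtypePiEquivPi (p := fun (_ : Fin k) x => x ∈ χ.ker)
      rw [← Nat.card_coe_set_eq, Nat.card_congr e]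
      simp [Nat.card_fun]
    have h2 : χ.ker.index = p := by
      rw [Subgroup.index_ker, MonoidHom.range_eq_top.2 (surjective_of_mem_normalizedHoms hχ)]
      simp
    rw [h1, ← mul_pow, ← Subgroup.card_mul_index χ.ker, h2]
  have hunion : kernelTuples s k p i ⊆
      ⋃ χ ∈ hfin.toFinset, {g : Fin k → G | ∀ j, χ (g j) = 1} := by
    rintro g ⟨χ, hχ, hg⟩
    simp only [Set.mem_iUnion]
    exact ⟨χ, hfin.mem_toFinset.2 hχ, hg⟩
  calc (kernelTuples s k p i).ncard * p ^ k
      ≤ (∑ χ ∈ hfin.toFinset, {g : Fin k → G | ∀ j, χ (g j) = 1}.ncard) * p ^ k := by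
        gcongr
        exact (Set.ncard_le_ncard hunion (Set.toFinite _)).trans
          (Finset.set_ncard_biUnion_le _ _)
    _ = (normalizedHoms s p i).ncard * Nat.card G ^ k := by
        rw [Finset.sum_mul, Finset.sum_congr rfl fun χ hχ => hker χ (hfin.mem_toFinset.1 hχ),
          Finset.sum_const, smul_eq_mul, Set.ncard_eq_toFinset_card _ hfin]
    _ ≤ _ := by gcongr

theorem ncard_kernelTuples_le {G : Type*} [CommGroup G] [Finite G] {d : ℕ}
    {s : Fin d → G} (hs : Subgroup.closure (Set.range s) = ⊤) {k p : ℕ} (hk : d + 1 ≤ k)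
    (hp : 2 ≤ p) (i : Fin d) :
    ((kernelTuples s k p i).ncard : ℝ) ≤
      1 / (p : ℝ) ^ 2 * (2 * 2 ^ ((d : ℤ) - (k : ℤ)) * (Nat.card G : ℝ) ^ k) := by
  have : NeZero p := ⟨by omega⟩
  have hp' : (2 : ℝ) ≤ p := by exact_mod_cast hp
  have hp0 : (0 : ℝ) < p := by linarith
  obtain ⟨m, rfl⟩ := Nat.exists_eq_add_of_le hk
  have h : ((kernelTuples s (d + 1 + m) p i).ncard : ℝ) * p ^ (d + 1 + m) ≤
      p ^ (i : ℕ) * (Nat.card G : ℝ) ^ (d + 1 + m) := by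
    exact_mod_cast ncard_kernelTuples_mul_le hs (d + 1 + m) p i
  have hpow : (p : ℝ) ^ (i : ℕ) * (p ^ 2 * 2 ^ m) ≤ p ^ (d + 1 + m) := by
    calc (p : ℝ) ^ (i : ℕ) * ((p : ℝ) ^ 2 * 2 ^ m) ≤ (p : ℝ) ^ (i : ℕ) * ((p : ℝ) ^ 2 * (p : ℝ) ^ m) := by gcongr
      _ = (p : ℝ) ^ ((i : ℕ) + 2 + m) := by ring
      _ ≤ _ := pow_le_pow_right₀ (by linarith) (by omega)
  have h2 : (2 : ℝ) * 2 ^ ((d : ℤ) - ((d + 1 + m : ℕ) : ℤ)) = 1 / 2 ^ m := by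
    rw [show (d : ℤ) - ((d + 1 + m : ℕ) : ℤ) = -1 + -(m : ℤ) by push_cast; ring,
      zpow_add₀ two_ne_zero, zpow_neg, zpow_neg, zpow_natCast]
    field_simp
  rw [h2, ← mul_assoc, one_div_mul_one_div, one_div_mul_eq_div, le_div_iff₀ (by positivity)]
  have hpi : (0 : ℝ) < p ^ (i : ℕ) := by positivity
  refine le_of_mul_le_mul_left ?_ hpi
  calc (p : ℝ) ^ (i : ℕ) * ((kernelTuples s (d + 1 + m) p i).ncard * ((p : ℝ) ^ 2 * 2 ^ m))
      = (kernelTuples s (d + 1 + m) p i).ncard * ((p : ℝ) ^ (i : ℕ) * ((p : ℝ) ^ 2 * 2 ^ m)) := by ring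
    _ ≤ (kernelTuples s (d + 1 + m) p i).ncard * (p : ℝ) ^ (d + 1 + m) := by gcongr
    _ ≤ _ := h

theorem sum_primeFactors_inv_sq_le (n : ℕ) :
    ∑ p ∈ n.primeFactors, (1 / (p : ℝ) ^ 2) ≤ 1 / 2 := by
  have hsub : n.primeFactors ⊆ Nat.primesBelow (2 * n + 3) := fun p hp =>
    Nat.mem_primesBelow.2 ⟨by have := Nat.le_of_mem_primeFactors hp; omega,
      Nat.prime_of_mem_primeFactors hp⟩
  have h : (0 : ℝ) ≤ 1 / (4 * ((n : ℝ) + 1)) := by positivity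
  linarith [Finset.sum_le_sum_of_subset_of_nonneg hsub
    (fun p _ _ => by positivity : ∀ p ∈ Nat.primesBelow (2 * n + 3), p ∉ n.primeFactors →
      (0 : ℝ) ≤ 1 / (p : ℝ) ^ 2), sum_primesBelow_inv_sq_le n]


/-- If a finite abelian group `G` admits a generating set of size `d`, then for any
`k ≥ d + 1`, the number of `k`-tuples of elements of `G` that do NOT generate `G` is
at most `d · 2^{d-k} · |G|^k` (as real numbers). -/
theorem card_non_generating_tuples_le {G : Type*} [CommGroup G] [Fintype G] (d : ℕ)
    (hgen : ∃ s : Finset G, s.card = d ∧ Subgroup.closure (s : Set G) = ⊤)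
    (k : ℕ) (hk : d + 1 ≤ k) :
    (Nat.card {g : Fin k → G // Subgroup.closure (Set.range g) ≠ ⊤} : ℝ) ≤
      (d : ℝ) * 2 ^ ((d : ℤ) - (k : ℤ)) * (Fintype.card G : ℝ) ^ k := by
  obtain ⟨S, rfl, hS⟩ := hgen
  let s : Fin S.card → G := fun i => S.equivFin.symm i
  have hs : Subgroup.closure (Set.range s) = ⊤ := by
    rw [← hS]
    congr 1
    have : s = Subtype.val ∘ S.equivFin.symm := rfl
    rw [this, S.equivFin.symm.surjective.range_comp]
    simp
  have hsub : {g : Fin k → G | Subgroup.closure (Set.range g) ≠ ⊤} ⊆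
      ⋃ p ∈ (Nat.card G).primeFactors, ⋃ i ∈ Finset.univ, kernelTuples s k p i := by
    intro g hg
    obtain ⟨p, hp, i, χ, hχ, hker⟩ := exists_normalizedHom_of_ne_top hs hg
    simp only [Set.mem_iUnion]
    exact ⟨p, hp, i, Finset.mem_univ i, χ, hχ,
      fun j => hker (Subgroup.subset_closure (Set.mem_range_self j))⟩
  have hcard : Nat.card {g : Fin k → G // Subgroup.closure (Set.range g) ≠ ⊤} ≤
      ∑ p ∈ (Nat.card G).primeFactors, ∑ i, (kernelTuples s k p i).ncard :=
    (Set.ncard_le_ncard hsub (Set.toFinite _)).trans <|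
      (Finset.set_ncard_biUnion_le _ _).trans <|
        Finset.sum_le_sum fun p _ => Finset.set_ncard_biUnion_le _ _
  set C : ℝ := 2 * 2 ^ ((S.card : ℤ) - (k : ℤ)) * (Nat.card G : ℝ) ^ k with hC
  have hC0 : 0 ≤ C := by positivity
  calc (Nat.card {g : Fin k → G // Subgroup.closure (Set.range g) ≠ ⊤} : ℝ)
      ≤ ∑ p ∈ (Nat.card G).primeFactors, ∑ i, ((kernelTuples s k p i).ncard : ℝ) := by
        exact_mod_cast hcard
    _ ≤ ∑ p ∈ (Nat.card G).primeFactors, ∑ _i : Fin S.card, 1 / (p : ℝ) ^ 2 * C :=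
        Finset.sum_le_sum fun p hp => Finset.sum_le_sum fun i _ =>
          ncard_kernelTuples_le hs hk (Nat.prime_of_mem_primeFactors hp).two_le i
    _ = (∑ p ∈ (Nat.card G).primeFactors, 1 / (p : ℝ) ^ 2) * (S.card * C) := by
        simp only [Finset.sum_const, Finset.card_univ, Fintype.card_fin, nsmul_eq_mul]
        rw [Finset.sum_mul]
        exact Finset.sum_congr rfl fun p _ => by ring
    _ ≤ 1 / 2 * (S.card * C) := by
        gcongr
        exact sum_primeFactors_inv_sq_le _
    _ = _ := by
        rw [hC, Nat.card_eq_fintype_card]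
        ring
end

section
/- Let G be a finite abelian group admitting a generating set of size d, and let m ≥ k ≥ d + 1 be integers. Then the number of m-tuples (g₁, …, g_m) ∈ G^m for which there exists a k-element subset S ⊆ {1, …, m} such that {g_i : i ∈ S} does not generate G is at most C(m, k) · d · 2^{d−k} · |G|^m, as an inequality of real numbers, where C(m, k) denotes the binomial coefficient. -/
/-- A maximal subgroup of a finite abelian group has prime index. -/
theorem prime_index_of_isCoatom {G : Type*} [CommGroup G] [Finite G] {H : Subgroup G}
    (hH : IsCoatom H) : H.index.Prime := by
  have h1 : IsSimpleOrder (Set.Ici H) := Set.isSimpleOrder_Ici_iff_isCoatom.mpr hH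
  have h2 : IsSimpleOrder (Subgroup (G ⧸ H)) :=
    OrderIso.isSimpleOrder_iff (β := Set.Ici H) (QuotientGroup.comapMk'OrderIso H) |>.mpr h1
  have h3 : Nontrivial (G ⧸ H) := Subgroup.nontrivial_iff.mp h2.toNontrivial
  have h4 : IsSimpleGroup (G ⧸ H) := ⟨fun K _ => h2.eq_bot_or_eq_top K⟩
  rw [Subgroup.index_eq_card]
  exact IsSimpleGroup.prime_card

/-- A subgroup of prime index `p` in an abelian group is the kernel of a homomorphism
to the cyclic group of order `p`. -/
theorem exists_ker_eq_of_index_eq {G : Type*} [CommGroup G] {p : ℕ} [Fact p.Prime]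
    {H : Subgroup G} (hH : H.index = p) :
    ∃ φ : G →* Multiplicative (ZMod p), φ.ker = H := by
  have h1 : Nat.card (G ⧸ H) = p := by rw [← hH, Subgroup.index_eq_card]
  have h2 : Nat.card (Multiplicative (ZMod p)) = p := by simp
  let e : (G ⧸ H) ≃* Multiplicative (ZMod p) := mulEquivOfPrimeCardEq h1 h2
  refine ⟨e.toMonoidHom.comp (QuotientGroup.mk' H), ?_⟩
  ext x
  simp

/-- The number `N` of subgroups of prime index `p` in a finite group with `d` generators satisfies
`N * (p - 1) < p ^ d`. -/
theorem card_index_eq_mul_lt {G : Type*} [CommGroup G] [Finite G] {s : Finset G}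
    (hs : Subgroup.closure (s : Set G) = ⊤) {p : ℕ} (hp : p.Prime) :
    Nat.card {H : Subgroup G // H.index = p} * (p - 1) < p ^ s.card := by
  classical
  have : Fact p.Prime := ⟨hp⟩
  have := Fintype.ofFinite {H : Subgroup G // H.index = p}
  choose φ hφ using fun H : {H : Subgroup G // H.index = p} => exists_ker_eq_of_index_eq H.2
  have horder (c : Multiplicative (ZMod p)) (hc : c ≠ 1) : orderOf c = p :=
    orderOf_eq_prime (by
      have h := pow_card_eq_one' (x := c)
      rwa [Nat.card_eq_fintype_card, Fintype.card_multiplicative, ZMod.card] at h) hc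
  have hpow (c : Multiplicative (ZMod p)) (i : Fin (p - 1)) (h : c ^ (i.1 + 1) = 1) : c = 1 := by
    by_contra hc
    have h1 := Nat.le_of_dvd (Nat.succ_pos _) (horder c hc ▸ orderOf_dvd_of_pow_eq_one h)
    have := i.2
    omega
  have hker (H : {H : Subgroup G // H.index = p}) (i : Fin (p - 1)) :
      (φ H ^ (i.1 + 1)).ker = H.1 := by
    rw [← hφ H]
    ext x
    simp only [MonoidHom.mem_ker, MonoidHom.pow_apply]
    exact ⟨hpow _ i, fun h => by rw [h, one_pow]⟩
  have hproper (H : {H : Subgroup G // H.index = p}) : ∃ x, x ∉ H.1 := by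
    by_contra! h
    have h1 : H.1 = ⊤ := eq_top_iff.mpr fun x _ => h x
    have h2 := H.2
    rw [h1, Subgroup.index_top] at h2
    exact hp.one_lt.ne h2
  let F : {H : Subgroup G // H.index = p} × Fin (p - 1) → s → Multiplicative (ZMod p) :=
    fun q x => (φ q.1 ^ (q.2.1 + 1)) x
  have hext {f g : G →* Multiplicative (ZMod p)} (h : ∀ x : s, f x = g x) : f = g :=
    MonoidHom.eq_of_eqOn_dense hs fun x hx => h ⟨x, hx⟩
  have hF : Function.Injective F := by
    rintro ⟨H, i⟩ ⟨K, j⟩ h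
    have h1 : φ H ^ (i.1 + 1) = φ K ^ (j.1 + 1) := hext fun x => congrFun h x
    have h2 : H = K := Subtype.ext (by rw [← hker H i, h1, hker K j])
    subst h2
    obtain ⟨x, hx⟩ := hproper H
    have hx1 : φ H x ≠ 1 := by
      rwa [← hφ H, MonoidHom.mem_ker] at hx
    have h3 : φ H x ^ (i.1 + 1) = φ H x ^ (j.1 + 1) := DFunLike.congr_fun h1 x
    have hi := i.2
    have hj := j.2
    have h4 := pow_injOn_Iio_orderOf (x := φ H x)
      (by rw [Set.mem_Iio, horder _ hx1]; omega) (by rw [Set.mem_Iio, horder _ hx1]; omega) h3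
    exact Prod.ext rfl (Fin.ext (Nat.succ_injective h4))
  have h1 : (1 : s → Multiplicative (ZMod p)) ∉ Set.range F := by
    rintro ⟨⟨H, i⟩, h⟩
    have h2 : φ H ^ (i.1 + 1) = 1 := hext fun x => congrFun h x
    obtain ⟨x, hx⟩ := hproper H
    rw [← hker H i, h2] at hx
    simp at hx
  have h2 := Fintype.card_lt_of_injective_of_notMem F hF h1
  simpa [Nat.card_eq_fintype_card] using h2

/-- The number of subgroups of prime index `p` in a finite abelian group with `d` generators is
at most `1 + p + ⋯ + p ^ (d - 1)`. -/
theorem card_index_eq_le {G : Type*} [CommGroup G] [Finite G] {s : Finset G}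
    (hs : Subgroup.closure (s : Set G) = ⊤) {p : ℕ} (hp : p.Prime) :
    Nat.card {H : Subgroup G // H.index = p} ≤ ∑ j ∈ Finset.range s.card, p ^ j := by
  have h1 := card_index_eq_mul_lt hs hp
  have h2 := Nat.geomSum_eq hp.two_le s.card
  rw [h2, Nat.le_div_iff_mul_le (Nat.sub_pos_of_lt hp.one_lt)]
  omega

/-- The sum of `p ^ (-2)` over primes `p < 2 * N + 3` is less than `1 / 2`. -/
theorem sum_primes_inv_sq_le (N : ℕ) :
    ∑ p ∈ Finset.range (2 * N + 3) with p.Prime, ((p : ℝ) ^ 2)⁻¹ ≤ 1 / 2 - 1 / (4 * (N + 1)) := by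
  rw [Finset.sum_filter]
  induction N with
  | zero => norm_num [Finset.sum_range_succ, Nat.prime_two, Nat.not_prime_zero, Nat.not_prime_one]
  | succ N ih =>
    have h1 : ¬ (2 * N + 3 + 1).Prime := fun h => by
      rcases h.eq_one_or_self_of_dvd 2 ⟨N + 2, by ring⟩ with h | h <;> omega
    rw [show 2 * (N + 1) + 3 = 2 * N + 3 + 1 + 1 by ring, Finset.sum_range_succ,
      Finset.sum_range_succ, if_neg h1, add_zero]
    have h2 : (if (2 * N + 3).Prime then (((2 * N + 3 : ℕ) : ℝ) ^ 2)⁻¹ else 0) ≤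
        1 / (4 * ((N : ℝ) + 1)) - 1 / (4 * (N + 1 + 1)) := by
      have h3 : 1 / (4 * ((N : ℝ) + 1)) - 1 / (4 * (N + 1 + 1)) =
          (4 * ((N : ℝ) + 1) * (N + 2))⁻¹ := by
        field_simp
        ring
      rw [h3]
      split_ifs
      · apply inv_anti₀ (by positivity)
        push_cast
        nlinarith
      · positivity
    rw [Nat.cast_add_one N]
    linarith

/-- A finite sum of `p ^ (-n)` over primes is at most `2 ^ (1 - n)`, for `n ≥ 2`. -/
theorem sum_primes_inv_pow_le {T : Finset ℕ} (hT : ∀ p ∈ T, p.Prime) (n : ℕ) :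
    ∑ p ∈ T, ((p : ℝ) ^ (n + 2))⁻¹ ≤ (2 ^ (n + 1))⁻¹ := by
  have h1 : ∑ p ∈ T, ((p : ℝ) ^ 2)⁻¹ ≤ 1 / 2 := by
    have hsub : T ⊆ {p ∈ Finset.range (2 * T.sup id + 3) | p.Prime} := fun p hp => by
      have : p ≤ T.sup id := Finset.le_sup (f := id) hp
      rw [Finset.mem_filter, Finset.mem_range]
      exact ⟨by omega, hT p hp⟩
    refine (Finset.sum_le_sum_of_subset_of_nonneg hsub fun _ _ _ => by positivity).trans
      ((sum_primes_inv_sq_le _).trans ?_)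
    rw [sub_le_self_iff]
    positivity
  calc ∑ p ∈ T, ((p : ℝ) ^ (n + 2))⁻¹
      ≤ ∑ p ∈ T, (2 ^ n)⁻¹ * ((p : ℝ) ^ 2)⁻¹ := by
        refine Finset.sum_le_sum fun p hp => ?_
        rw [pow_add, mul_inv]
        have : (2 : ℝ) ≤ p := by exact_mod_cast (hT p hp).two_le
        gcongr
    _ ≤ (2 ^ n)⁻¹ * (1 / 2) := by
        rw [← Finset.mul_sum]
        gcongr
    _ = (2 ^ (n + 1))⁻¹ := by rw [pow_succ, mul_inv, one_div]

/-- For `k > d` and any finite set of primes `T`, the sum of `(1 + p + ⋯ + p ^ (d - 1)) / p ^ k`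
over `p ∈ T` is at most `d * 2 ^ (d - k)`. -/
theorem sum_primes_geomSum_div_le {T : Finset ℕ} (hT : ∀ p ∈ T, p.Prime) {d k : ℕ}
    (hk : d + 1 ≤ k) :
    ∑ p ∈ T, (∑ j ∈ Finset.range d, (p : ℝ) ^ j) / p ^ k ≤ d * 2 ^ ((d : ℤ) - (k : ℤ)) := by
  simp_rw [Finset.sum_div]
  rw [Finset.sum_comm, ← nsmul_eq_mul]
  conv_rhs => rw [← Finset.card_range d]
  refine Finset.sum_le_card_nsmul _ _ _ fun j hj => ?_
  rw [Finset.card_range]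
  have hj := Finset.mem_range.mp hj
  obtain ⟨n, rfl⟩ : ∃ n, k = j + (n + 2) := ⟨k - j - 2, by omega⟩
  calc ∑ p ∈ T, (p : ℝ) ^ j / p ^ (j + (n + 2)) = ∑ p ∈ T, ((p : ℝ) ^ (n + 2))⁻¹ := by
        refine Finset.sum_congr rfl fun p hp => ?_
        have : (p : ℝ) ≠ 0 := by exact_mod_cast (hT p hp).ne_zero
        rw [pow_add]
        field_simp
    _ ≤ (2 ^ (n + 1))⁻¹ := sum_primes_inv_pow_le hT n
    _ = (2 : ℝ) ^ (-((n + 1 : ℕ) : ℤ)) := by rw [zpow_neg, zpow_natCast]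
    _ ≤ 2 ^ ((d : ℤ) - ((j + (n + 2) : ℕ) : ℤ)) := by
        apply zpow_le_zpow_right₀ one_le_two
        push_cast
        omega

/-- The number of tuples whose entries indexed by `S` all lie in the subgroup `H`. -/
theorem card_tuples_mem_subgroup {G ι : Type*} [Group G] [Fintype G] [Fintype ι]
    (S : Finset ι) (H : Subgroup G) :
    (Nat.card {g : ι → G // ∀ i ∈ S, g i ∈ H} : ℝ) =
      (Fintype.card G : ℝ) ^ Fintype.card ι / (H.index : ℝ) ^ S.card := by
  classical
  have h1 : Nat.card {g : ι → G // ∀ i ∈ S, g i ∈ H} =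
      ∏ i : ι, if i ∈ S then Nat.card H else Nat.card G := by
    have : {g : ι → G | ∀ i ∈ S, g i ∈ H} =
        Set.pi Set.univ fun i => if i ∈ S then (H : Set G) else Set.univ := by
      ext g
      simp only [Set.mem_ofPred_eq, Set.mem_pi, Set.mem_univ, true_imp_iff]
      refine forall_congr' fun i => ?_
      split_ifs with h <;> simp [h]
    rw [show Nat.card {g : ι → G // ∀ i ∈ S, g i ∈ H} =
      Nat.card {g : ι → G | ∀ i ∈ S, g i ∈ H} from rfl, this,
      Nat.card_congr (Equiv.Set.univPi _), Nat.card_pi]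
    refine Finset.prod_congr rfl fun i _ => ?_
    split_ifs <;> simp
  have h2 : (Nat.card H : ℝ) * H.index = Nat.card G := by exact_mod_cast H.card_mul_index
  have h3 : (H.index : ℝ) ≠ 0 := by exact_mod_cast H.index_ne_zero_of_finite
  have h4 : (H.index : ℝ) ^ S.card = ∏ i : ι, if i ∈ S then (H.index : ℝ) else 1 := by
    simp
  rw [h1, eq_div_iff (pow_ne_zero _ h3), ← Nat.card_eq_fintype_card (α := G), h4, Nat.cast_prod,
    ← Finset.prod_mul_distrib, ← Finset.card_univ, ← Finset.prod_const]
  refine Finset.prod_congr rfl fun i _ => ?_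
  split_ifs
  · exact h2
  · exact mul_one _

/-- If a finite abelian group `G` admits a generating set of size `d`, and
`m ≥ k ≥ d + 1`, then the number of `m`-tuples of elements of `G` having some
`k`-element subset of entries that fails to generate `G` is at most
`C(m,k) · d · 2^{d-k} · |G|^m` (as real numbers). -/
theorem card_tuples_with_bad_subset_le {G : Type*} [CommGroup G] [Fintype G] (d : ℕ)
    (hgen : ∃ s : Finset G, s.card = d ∧ Subgroup.closure (s : Set G) = ⊤)
    (k m : ℕ) (hk : d + 1 ≤ k) (hm : k ≤ m) :
    (Nat.card {g : Fin m → G // ∃ S : Finset (Fin m), S.card = k ∧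
        Subgroup.closure (g '' (S : Set (Fin m))) ≠ ⊤} : ℝ) ≤
      (m.choose k : ℝ) * d * 2 ^ ((d : ℤ) - (k : ℤ)) * (Fintype.card G : ℝ) ^ m := by
  classical
  obtain ⟨s, rfl, hs⟩ := hgen
  let P := (Nat.card G).primeFactors
  let bad (S : Finset (Fin m)) (H : Subgroup G) : Finset (Fin m → G) := {g | ∀ i ∈ S, g i ∈ H}
  let M (p : ℕ) : Finset (Subgroup G) := {H | H.index = p}
  have hbad (S : Finset (Fin m)) (hS : S.card = k) (p : ℕ) (H : Subgroup G) (hH : H ∈ M p) :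
      ((bad S H).card : ℝ) = (Fintype.card G : ℝ) ^ m / (p : ℝ) ^ k := by
    have h := card_tuples_mem_subgroup S H
    rwa [Nat.card_eq_fintype_card, Fintype.card_subtype, Fintype.card_fin, hS,
      (Finset.mem_filter.mp hH).2] at h
  have hM (p : ℕ) (hp : p ∈ P) :
      ((M p).card : ℝ) ≤ ∑ j ∈ Finset.range s.card, (p : ℝ) ^ j := by
    have h := card_index_eq_le hs (Nat.prime_of_mem_primeFactors hp)
    rw [Nat.card_eq_fintype_card, Fintype.card_subtype] at h
    exact_mod_cast h
  have hcover : ({g | ∃ S : Finset (Fin m), S.card = k ∧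
      Subgroup.closure (g '' (S : Set (Fin m))) ≠ ⊤} : Finset (Fin m → G)) ⊆
      (Finset.univ.powersetCard k).biUnion fun S => P.biUnion fun p => (M p).biUnion (bad S) := by
    intro g hg
    obtain ⟨S, hS, hne⟩ := (Finset.mem_filter.mp hg).2
    obtain ⟨H, hH, hle⟩ := (eq_top_or_exists_le_coatom _).resolve_left hne
    simp only [Finset.mem_biUnion, Finset.mem_powersetCard]
    refine ⟨S, ⟨Finset.subset_univ _, hS⟩, H.index, ?_, H, by simp [M], ?_⟩
    · exact Nat.mem_primeFactors.mpr
        ⟨prime_index_of_isCoatom hH, H.index_dvd_card, Nat.card_pos.ne'⟩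
    · refine Finset.mem_filter.mpr ⟨Finset.mem_univ _, fun i hi => ?_⟩
      exact hle (Subgroup.subset_closure ⟨i, hi, rfl⟩)
  rw [Nat.card_eq_fintype_card, Fintype.card_subtype]
  calc _ ≤ ((∑ S ∈ Finset.univ.powersetCard k, ∑ p ∈ P, ∑ H ∈ M p, (bad S H).card : ℕ) : ℝ) := by
        refine Nat.cast_le.mpr ((Finset.card_le_card hcover).trans ?_)
        refine Finset.card_biUnion_le.trans (Finset.sum_le_sum fun S _ => ?_)
        exact Finset.card_biUnion_le.trans (Finset.sum_le_sum fun p _ => Finset.card_biUnion_le)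
    _ = ∑ S ∈ (Finset.univ : Finset (Fin m)).powersetCard k,
          ∑ p ∈ P, (M p).card * ((Fintype.card G : ℝ) ^ m / (p : ℝ) ^ k) := by
        push_cast
        refine Finset.sum_congr rfl fun S hS => Finset.sum_congr rfl fun p _ => ?_
        rw [Finset.sum_congr rfl (hbad S (Finset.mem_powersetCard.mp hS).2 p), Finset.sum_const,
          nsmul_eq_mul]
    _ = m.choose k * ((∑ p ∈ P, (M p).card / (p : ℝ) ^ k) * (Fintype.card G : ℝ) ^ m) := by
        rw [Finset.sum_const, Finset.card_powersetCard, Finset.card_univ, Fintype.card_fin,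
          nsmul_eq_mul, Finset.sum_mul]
        congr 1
        exact Finset.sum_congr rfl fun p _ => by ring
    _ ≤ m.choose k * ((∑ p ∈ P, (∑ j ∈ Finset.range s.card, (p : ℝ) ^ j) / (p : ℝ) ^ k) *
          (Fintype.card G : ℝ) ^ m) := by
        gcongr with p hp
        exact hM p hp
    _ ≤ m.choose k * ((s.card * 2 ^ ((s.card : ℤ) - (k : ℤ))) * (Fintype.card G : ℝ) ^ m) := by
        gcongr
        exact sum_primes_geomSum_div_le (fun p hp => Nat.prime_of_mem_primeFactors hp) hk
    _ = _ := by ring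
end

section
/- Let α and γ be real numbers with 1 < γ < α satisfying (eα/(α−γ))^{α−γ} · 2^{1−γ} < 1. Then there exists d₀ such that for all integers d ≥ d₀, C(⌊αd⌋, ⌊γd⌋) · d · 2^{d−⌊γd⌋} < 1/2, where C(m, k) denotes the binomial coefficient and the inequality is between real numbers. -/
/-- A Chernoff-type bound: comparing `C(n, k) x ^ k` with `(1 + x) ^ n ≤ exp (x n)`. -/
theorem choose_mul_pow_le_exp {x : ℝ} (hx : 0 ≤ x) {n k : ℕ} (hk : k ≤ n) :
    (n.choose k : ℝ) * x ^ k ≤ Real.exp (x * n) := by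
  calc (n.choose k : ℝ) * x ^ k
      ≤ ∑ i ∈ Finset.range (n + 1), x ^ i * 1 ^ (n - i) * (n.choose i : ℝ) := by
        have := Finset.single_le_sum (f := fun i => x ^ i * 1 ^ (n - i) * (n.choose i : ℝ))
          (fun i _ => by positivity) (Finset.mem_range.2 (Nat.lt_succ_of_le hk))
        simpa [mul_comm] using this
    _ = (x + 1) ^ n := (add_pow x 1 n).symm
    _ ≤ Real.exp x ^ n := by
        gcongr
        exact Real.add_one_le_exp x
    _ = Real.exp (x * n) := by rw [← Real.exp_nat_mul, mul_comm]

theorem choose_floor_mul_le {α γ : ℝ} (hγ : 0 < γ) (hγα : γ < α) (d : ℕ) :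
    (Nat.choose ⌊α * (d : ℝ)⌋₊ ⌊γ * (d : ℝ)⌋₊ : ℝ) ≤
      (α / (α - γ)) * ((Real.exp 1 * α / (α - γ)) ^ (α - γ)) ^ (d : ℝ) := by
  have hδ : 0 < α - γ := sub_pos.2 hγα
  have hα : 0 < α := hγ.trans hγα
  have hmn : ⌊γ * (d : ℝ)⌋₊ ≤ ⌊α * (d : ℝ)⌋₊ := by gcongr
  have hn : (⌊α * (d : ℝ)⌋₊ : ℝ) ≤ α * d := Nat.floor_le (by positivity)
  have hm : γ * d < ⌊γ * (d : ℝ)⌋₊ + 1 := Nat.lt_floor_add_one _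
  set n := ⌊α * (d : ℝ)⌋₊
  set m := ⌊γ * (d : ℝ)⌋₊
  set B := α / (α - γ) with hB
  have hB0 : 0 < B := by positivity
  have hB1 : 1 ≤ B := by rw [hB, le_div_iff₀ hδ]; linarith
  have hk : ((n - m : ℕ) : ℝ) ≤ (α - γ) * d + 1 := by
    rw [Nat.cast_sub hmn]; linarith
  have hchoose : (n.choose m : ℝ) ≤ Real.exp (B⁻¹ * n) * B ^ (n - m) := by
    have := choose_mul_pow_le_exp (inv_nonneg.2 hB0.le) (Nat.sub_le n m)
    rwa [Nat.choose_symm hmn, inv_pow, ← div_eq_mul_inv, div_le_iff₀ (by positivity)] at this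
  have hexp : Real.exp (B⁻¹ * n) ≤ Real.exp ((α - γ) * d) := by
    refine Real.exp_le_exp.2 ?_
    calc B⁻¹ * n ≤ B⁻¹ * (α * d) := by gcongr
      _ = (α - γ) * d := by rw [hB]; field_simp
  have hpow : B ^ (n - m) ≤ B ^ ((α - γ) * d) * B := by
    rw [← Real.rpow_natCast, ← Real.rpow_add_one hB0.ne']
    exact Real.rpow_le_rpow_of_exponent_le hB1 hk
  calc (n.choose m : ℝ) ≤ Real.exp ((α - γ) * d) * (B ^ ((α - γ) * d) * B) :=
        hchoose.trans (by gcongr)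
    _ = B * ((Real.exp 1 * α / (α - γ)) ^ (α - γ)) ^ (d : ℝ) := by
        rw [mul_div_assoc, ← hB, ← Real.rpow_mul (by positivity),
          Real.mul_rpow (Real.exp_pos 1).le hB0.le, Real.exp_one_rpow]
        ring

theorem two_zpow_sub_floor_le (γ : ℝ) (d : ℕ) :
    (2 : ℝ) ^ ((d : ℤ) - (⌊γ * (d : ℝ)⌋₊ : ℤ)) ≤ 2 * ((2 : ℝ) ^ (1 - γ)) ^ (d : ℝ) := by
  have hm : γ * d < ⌊γ * (d : ℝ)⌋₊ + 1 := Nat.lt_floor_add_one _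
  rw [← Real.rpow_intCast, ← Real.rpow_mul two_pos.le, mul_comm (2 : ℝ),
    ← Real.rpow_add_one two_ne_zero]
  refine Real.rpow_le_rpow_of_exponent_le one_le_two ?_
  push_cast
  linarith

/-- If `1 < γ < α` and `(eα/(α-γ))^{α-γ} · 2^{1-γ} < 1`, then for all sufficiently
large `d`, `C(⌊αd⌋, ⌊γd⌋) · d · 2^{d-⌊γd⌋} < 1/2`. -/
theorem binom_bound_eventually (α γ : ℝ) (hγ : 1 < γ) (hγα : γ < α)
    (h : (Real.exp 1 * α / (α - γ)) ^ (α - γ) * 2 ^ (1 - γ) < 1) :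
    ∃ d₀ : ℕ, ∀ d : ℕ, d₀ ≤ d →
      (Nat.choose ⌊α * (d : ℝ)⌋₊ ⌊γ * (d : ℝ)⌋₊ : ℝ) * (d : ℝ) *
          2 ^ ((d : ℤ) - (⌊γ * (d : ℝ)⌋₊ : ℤ)) < 1 / 2 := by
  have hδ : 0 < α - γ := sub_pos.2 hγα
  have hγ0 : 0 < γ := one_pos.trans hγ
  have hα : 0 < α := hγ0.trans hγα
  have hlim := (tendsto_self_mul_const_pow_of_lt_one (by positivity) h).const_mul
    (2 * (α / (α - γ)))
  rw [mul_zero] at hlim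
  obtain ⟨d₀, hd₀⟩ := Filter.eventually_atTop.1 (hlim.eventually_lt_const one_half_pos)
  refine ⟨d₀, fun d hd => lt_of_le_of_lt ?_ (hd₀ d hd)⟩
  calc _ ≤ (α / (α - γ)) * ((Real.exp 1 * α / (α - γ)) ^ (α - γ)) ^ (d : ℝ) * d *
        (2 * ((2 : ℝ) ^ (1 - γ)) ^ (d : ℝ)) := by
        gcongr
        · exact choose_floor_mul_le hγ0 hγα d
        · exact two_zpow_sub_floor_le γ d
    _ = _ := by
        rw [Real.rpow_natCast, Real.rpow_natCast, mul_pow]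
        ring
end

section
/- Let α and γ be real numbers with 1 < γ < α satisfying (eα/(α−γ))^{α−γ} · 2^{1−γ} < 1. Then there exists d₀ such that for all integers d ≥ d₀ and every finite abelian group G admitting a generating set of size d, setting m = ⌊αd⌋ and k = ⌊γd⌋, the number of m-tuples (g₁, …, g_m) ∈ G^m for which some k-element subset S ⊆ {1, …, m} has {g_i : i ∈ S} not generating G is less than |G|^m / 2. Equivalently, with probability greater than 1/2 over m independent uniform samples from G, every k of the samples generate G. -/
open Finset

theorem Subgroup.exists_monoidHom_units_complex_ne_one {G : Type*} [CommGroup G] [Finite G]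
    {H : Subgroup G} (hH : H ≠ ⊤) : ∃ χ : G →* ℂˣ, χ ≠ 1 ∧ H ≤ χ.ker := by
  obtain ⟨a, ha⟩ : ∃ a, a ∉ H := by
    by_contra! h
    exact hH ((Subgroup.eq_top_iff' H).2 h)
  obtain ⟨φ, hφ⟩ := CommGroup.exists_apply_ne_one_of_hasEnoughRootsOfUnity (G ⧸ H) ℂ
    (a := (a : G ⧸ H)) (by rwa [Ne, QuotientGroup.eq_one_iff])
  refine ⟨φ.comp (QuotientGroup.mk' H), fun h => hφ (DFunLike.congr_fun h a), fun x hx => ?_⟩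
  rw [MonoidHom.mem_ker, MonoidHom.comp_apply, QuotientGroup.mk'_apply,
    (QuotientGroup.eq_one_iff x).2 hx, map_one]

theorem MonoidHom.pow_index_ker {G M : Type*} [Group G] [CommGroup M] (χ : G →* M) (g : G) :
    χ g ^ χ.ker.index = 1 := by
  rw [← map_pow]
  exact χ.ker.pow_index_mem g

theorem MonoidHom.card_filter_index_ker_le {G : Type*} [CommGroup G] [Fintype (G →* ℂˣ)]
    {s : Finset G} (hs : Subgroup.closure (s : Set G) = ⊤) {n : ℕ} (hn : n ≠ 0) :
    #{χ : G →* ℂˣ | χ.ker.index = n} ≤ n ^ #s := by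
  classical
  have : NeZero n := ⟨hn⟩
  let f : {χ : G →* ℂˣ // χ.ker.index = n} → (s → rootsOfUnity n ℂ) :=
    fun χ x => ⟨χ.1 x, by
      rw [mem_rootsOfUnity]
      simpa only [χ.2] using χ.1.pow_index_ker (x : G)⟩
  have hf : f.Injective := fun χ ψ h => Subtype.ext <|
    MonoidHom.eq_of_eqOn_dense hs fun x hx => congrArg Subtype.val (congrFun h ⟨x, hx⟩)
  calc #{χ : G →* ℂˣ | χ.ker.index = n} = Nat.card {χ : G →* ℂˣ // χ.ker.index = n} := by
        rw [Nat.card_eq_fintype_card, Fintype.card_subtype]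
    _ ≤ Nat.card (s → rootsOfUnity n ℂ) := Nat.card_le_card_of_injective f hf
    _ = Nat.card (rootsOfUnity n ℂ) ^ #s := by simp [Nat.card_fun]
    _ ≤ n ^ #s := Nat.pow_le_pow_left (card_rootsOfUnity ℂ n) _

theorem Subgroup.card_filter_pi_mem_mul_index_pow {ι G : Type*} [Fintype ι] [DecidableEq ι]
    [Group G] [Fintype G] (H : Subgroup G) [DecidablePred (· ∈ H)] (S : Finset ι) :
    #{g : ι → G | ∀ i ∈ S, g i ∈ H} * H.index ^ #S = Fintype.card G ^ Fintype.card ι := by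
  have hpi : ({g : ι → G | ∀ i ∈ S, g i ∈ H} : Finset (ι → G)) =
      Fintype.piFinset fun i => if i ∈ S then ({x | x ∈ H} : Finset G) else univ := by
    ext g
    simp only [mem_filter, mem_univ, true_and, Fintype.mem_piFinset]
    refine forall_congr' fun i => ?_
    split_ifs with hi <;> simp [hi]
  have hH : #({x | x ∈ H} : Finset G) * H.index = Fintype.card G := by
    rw [← Fintype.card_subtype, ← Nat.card_eq_fintype_card, ← Nat.card_eq_fintype_card]
    exact H.card_mul_index
  have hprod (f : Bool → ℕ) : ∏ i : ι, f (decide (i ∈ S)) = f true ^ #S * f false ^ #Sᶜ := by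
    rw [← Finset.prod_mul_prod_compl S, Finset.prod_congr rfl (g := fun _ => f true)
      (fun i hi => by simp [hi]), Finset.prod_congr rfl (s₁ := Sᶜ) (g := fun _ => f false)
      (fun i hi => by rw [decide_eq_false (mem_compl.1 hi)])]
    simp
  have hcard : ∏ i : ι, #(if i ∈ S then ({x | x ∈ H} : Finset G) else univ) =
      #({x | x ∈ H} : Finset G) ^ #S * Fintype.card G ^ #Sᶜ := by
    simpa using hprod fun b => #(if b then ({x | x ∈ H} : Finset G) else univ)
  rw [hpi, Fintype.card_piFinset, hcard, mul_right_comm, ← mul_pow, hH, ← pow_add,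
    card_add_card_compl]

open Classical in
theorem card_filter_closure_image_ne_top_le {ι G : Type*} [Fintype ι] [CommGroup G] [Fintype G]
    {s : Finset G} (hs : Subgroup.closure (s : Set G) = ⊤) (S : Finset ι) :
    (#{g : ι → G | Subgroup.closure (g '' (S : Set ι)) ≠ ⊤} : ℝ) ≤
      (Fintype.card G : ℝ) ^ Fintype.card ι *
        ∑ n ∈ Icc 2 (Fintype.card G), (n : ℝ) ^ #s / (n : ℝ) ^ #S := by
  have : Fintype (G →* ℂˣ) := Fintype.ofFinite _
  set X : Finset (G →* ℂˣ) := {χ | χ ≠ 1} with hX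
  have hsub : ({g : ι → G | Subgroup.closure (g '' (S : Set ι)) ≠ ⊤} : Finset (ι → G)) ⊆
      X.biUnion fun χ => {g : ι → G | ∀ i ∈ S, g i ∈ χ.ker} := by
    intro g hg
    obtain ⟨χ, hχ, hle⟩ := Subgroup.exists_monoidHom_units_complex_ne_one (mem_filter.1 hg).2
    simp only [mem_biUnion, mem_filter, mem_univ, true_and, hX]
    exact ⟨χ, hχ, fun i hi => hle (Subgroup.subset_closure ⟨i, hi, rfl⟩)⟩
  have hterm (χ : G →* ℂˣ) : (#{g : ι → G | ∀ i ∈ S, g i ∈ χ.ker} : ℝ) =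
      (Fintype.card G : ℝ) ^ Fintype.card ι * ((χ.ker.index : ℝ) ^ #S)⁻¹ := by
    have h0 : (χ.ker.index : ℝ) ≠ 0 := Nat.cast_ne_zero.2 Subgroup.index_ne_zero_of_finite
    rw [← div_eq_mul_inv, eq_div_iff (pow_ne_zero _ h0)]
    exact_mod_cast χ.ker.card_filter_pi_mem_mul_index_pow S
  have hmaps : ∀ χ ∈ X, χ.ker.index ∈ Icc 2 (Fintype.card G) := by
    intro χ hχ
    have h0 : χ.ker.index ≠ 0 := Subgroup.index_ne_zero_of_finite
    have h1 : χ.ker.index ≠ 1 := by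
      rw [Ne, Subgroup.index_eq_one, MonoidHom.ker_eq_top_iff]
      exact (mem_filter.1 hχ).2
    have h2 := Nat.le_of_dvd Nat.card_pos χ.ker.index_dvd_card
    rw [Nat.card_eq_fintype_card] at h2
    exact mem_Icc.2 ⟨by omega, h2⟩
  calc (#{g : ι → G | Subgroup.closure (g '' (S : Set ι)) ≠ ⊤} : ℝ)
      ≤ ∑ χ ∈ X, (#{g : ι → G | ∀ i ∈ S, g i ∈ χ.ker} : ℝ) := by
        exact_mod_cast (card_le_card hsub).trans card_biUnion_le
    _ = (Fintype.card G : ℝ) ^ Fintype.card ι * ∑ χ ∈ X, ((χ.ker.index : ℝ) ^ #S)⁻¹ := by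
        rw [mul_sum]
        exact sum_congr rfl fun χ _ => hterm χ
    _ ≤ _ := by
        gcongr
        rw [← sum_fiberwise_of_maps_to hmaps]
        refine sum_le_sum fun n hn => ?_
        have hn0 : n ≠ 0 := by have := (mem_Icc.1 hn).1; omega
        rw [sum_congr rfl (g := fun _ => ((n : ℝ) ^ #S)⁻¹)
          (fun χ hχ => by rw [(mem_filter.1 hχ).2]), sum_const, nsmul_eq_mul, div_eq_mul_inv]
        gcongr
        exact_mod_cast (card_le_card (filter_subset_filter _ (subset_univ X))).trans
          (MonoidHom.card_filter_index_ker_le hs hn0)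

theorem sum_Icc_two_pow_div_pow_le {d k : ℕ} (hdk : d + 2 ≤ k) (N : ℕ) :
    ∑ n ∈ Icc 2 N, (n : ℝ) ^ d / (n : ℝ) ^ k ≤ 4 * ((2 : ℝ) ^ d / 2 ^ k) := by
  obtain ⟨t, rfl⟩ := Nat.exists_eq_add_of_le hdk
  have hterm : ∀ n ∈ Icc 2 N, (n : ℝ) ^ d / (n : ℝ) ^ (d + 2 + t) ≤
      ((2 : ℝ) ^ t)⁻¹ * ((n : ℝ) ^ 2)⁻¹ := by
    intro n hn
    have h2 : (2 : ℝ) ≤ n := by exact_mod_cast (mem_Icc.1 hn).1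
    have h0 : (0 : ℝ) < n := by linarith
    calc (n : ℝ) ^ d / (n : ℝ) ^ (d + 2 + t) = ((n : ℝ) ^ t)⁻¹ * ((n : ℝ) ^ 2)⁻¹ := by
          field_simp
          ring
      _ ≤ _ := by gcongr
  have hsum : ∑ n ∈ Icc 2 N, ((n : ℝ) ^ 2)⁻¹ ≤ 1 := by
    have hsub : Icc 2 N ⊆ Ioo 1 (N + 1) := fun n hn => by
      simp only [mem_Icc, mem_Ioo] at hn ⊢
      omega
    calc ∑ n ∈ Icc 2 N, ((n : ℝ) ^ 2)⁻¹ ≤ ∑ n ∈ Ioo 1 (N + 1), ((n : ℝ) ^ 2)⁻¹ :=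
          sum_le_sum_of_subset_of_nonneg hsub fun _ _ _ => by positivity
      _ ≤ 2 / ((1 : ℕ) + 1) := sum_Ioo_inv_sq_le 1 (N + 1)
      _ = 1 := by norm_num
  calc _ ≤ ∑ n ∈ Icc 2 N, ((2 : ℝ) ^ t)⁻¹ * ((n : ℝ) ^ 2)⁻¹ := sum_le_sum hterm
    _ ≤ ((2 : ℝ) ^ t)⁻¹ * 1 := by
        rw [← mul_sum]
        gcongr
    _ = _ := by
        field_simp
        ring

theorem Nat.choose_le_exp_mul_div_pow (m j : ℕ) {t : ℝ} (ht : 0 < t) :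
    (m.choose j : ℝ) ≤ Real.exp (t * m) / t ^ j := by
  rw [le_div_iff₀ (pow_pos ht j)]
  rcases lt_or_ge m j with hj | hj
  · rw [Nat.choose_eq_zero_of_lt hj]
    simpa using (Real.exp_pos _).le
  calc (m.choose j : ℝ) * t ^ j ≤ ∑ i ∈ range (m + 1), t ^ i * 1 ^ (m - i) * (m.choose i : ℝ) := by
        have := single_le_sum (f := fun i => t ^ i * 1 ^ (m - i) * (m.choose i : ℝ))
          (fun i _ => by positivity) (mem_range.2 (Nat.lt_succ_of_le hj))
        simpa [mul_comm] using this
    _ = (t + 1) ^ m := (add_pow t 1 m).symm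
    _ ≤ Real.exp t ^ m := by gcongr; exact Real.add_one_le_exp t
    _ = Real.exp (t * m) := by rw [← Real.exp_nat_mul, mul_comm]

theorem choose_floor_mul_two_pow_le {α γ : ℝ} (hγ : 1 < γ) (hγα : γ < α) (d : ℕ) :
    ((⌊α * (d : ℝ)⌋₊.choose ⌊γ * (d : ℝ)⌋₊ : ℕ) : ℝ) * (2 ^ d / 2 ^ ⌊γ * (d : ℝ)⌋₊) ≤
      2 * α / (α - γ) * ((Real.exp 1 * α / (α - γ)) ^ (α - γ) * 2 ^ (1 - γ)) ^ d := by
  set m := ⌊α * (d : ℝ)⌋₊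
  set k := ⌊γ * (d : ℝ)⌋₊
  have hα : 0 < α := by linarith
  have hδ : 0 < α - γ := by linarith
  have hkm : k ≤ m := Nat.floor_mono (by gcongr)
  have hm_le : (m : ℝ) ≤ α * d := Nat.floor_le (by positivity)
  have hk_lt : γ * d < k + 1 := Nat.lt_floor_add_one _
  set t := (α - γ) / α with ht
  have ht0 : 0 < t := div_pos hδ hα
  have ht1 : t ≤ 1 := by rw [ht, div_le_one hα]; linarith
  have hchoose : ((m.choose k : ℕ) : ℝ) ≤
      Real.exp ((α - γ) * d) * (t⁻¹ ^ ((α - γ) * d) * t⁻¹) := by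
    rw [← Nat.choose_symm hkm]
    refine (Nat.choose_le_exp_mul_div_pow m (m - k) ht0).trans ?_
    rw [div_eq_mul_inv, ← inv_pow]
    have hti : 1 ≤ t⁻¹ := (one_le_inv₀ ht0).2 ht1
    gcongr ?_ * ?_
    · rw [Real.exp_le_exp]
      calc t * m ≤ t * (α * d) := by gcongr
        _ = (α - γ) * d := by rw [ht]; field_simp
    · rw [← Real.rpow_natCast, ← Real.rpow_add_one (by positivity)]
      refine Real.rpow_le_rpow_of_exponent_le hti ?_
      rw [Nat.cast_sub hkm]
      linarith
  have htwo : (2 : ℝ) ^ d / 2 ^ k ≤ 2 * 2 ^ ((1 - γ) * d) := by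
    rw [← Real.rpow_natCast, ← Real.rpow_natCast, ← Real.rpow_sub two_pos, mul_comm (2 : ℝ),
      ← Real.rpow_add_one two_ne_zero]
    exact Real.rpow_le_rpow_of_exponent_le one_le_two (by linarith)
  calc _ ≤ Real.exp ((α - γ) * d) * (t⁻¹ ^ ((α - γ) * d) * t⁻¹) * (2 * 2 ^ ((1 - γ) * d)) := by
        gcongr
    _ = _ := by
        have hbase : Real.exp 1 * α / (α - γ) = Real.exp 1 * t⁻¹ := by rw [ht]; field_simp
        have hconst : 2 * α / (α - γ) = 2 * t⁻¹ := by rw [ht]; field_simp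
        rw [hbase, hconst, Real.mul_rpow (Real.exp_pos 1).le (by positivity), mul_pow, mul_pow,
          Real.exp_one_rpow, ← Real.exp_nat_mul, Real.rpow_mul_natCast (by positivity),
          Real.rpow_mul_natCast two_pos.le, mul_comm (d : ℝ)]
        ring


/-- If `1 < γ < α` and `(eα/(α-γ))^{α-γ} · 2^{1-γ} < 1`, then for all sufficiently
large `d` and every finite abelian group `G` with a generating set of size `d`,
setting `m = ⌊αd⌋` and `k = ⌊γd⌋`, fewer than half of all `m`-tuples of elements of
`G` have some `k`-element subset of entries failing to generate `G`; equivalently,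
with probability `> 1/2` over `m` uniform samples, every `k` of them generate `G`. -/
theorem subsets_generate_whp (α γ : ℝ) (hγ : 1 < γ) (hγα : γ < α)
    (h : (Real.exp 1 * α / (α - γ)) ^ (α - γ) * 2 ^ (1 - γ) < 1) :
    ∃ d₀ : ℕ, ∀ d : ℕ, d₀ ≤ d →
      ∀ (G : Type) [CommGroup G] [Fintype G],
        (∃ s : Finset G, s.card = d ∧ Subgroup.closure (s : Set G) = ⊤) →
        (Nat.card {g : Fin ⌊α * (d : ℝ)⌋₊ → G //
            ∃ S : Finset (Fin ⌊α * (d : ℝ)⌋₊), S.card = ⌊γ * (d : ℝ)⌋₊ ∧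
              Subgroup.closure (g '' (S : Set (Fin ⌊α * (d : ℝ)⌋₊))) ≠ ⊤} : ℝ) <
          (Fintype.card G : ℝ) ^ (⌊α * (d : ℝ)⌋₊ : ℕ) / 2 := by
  classical
  set q := (Real.exp 1 * α / (α - γ)) ^ (α - γ) * 2 ^ (1 - γ) with hq
  have hα : 0 < α := by linarith
  have hδ : 0 < α - γ := by linarith
  have hq0 : 0 ≤ q := by positivity
  have hlim : Filter.Tendsto (fun d : ℕ => 4 * (2 * α / (α - γ) * q ^ d)) Filter.atTop (nhds 0) := by
    simpa using ((tendsto_pow_atTop_nhds_zero_of_lt_one hq0 h).const_mul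
      (2 * α / (α - γ))).const_mul 4
  obtain ⟨d₁, hd₁⟩ := Filter.eventually_atTop.1 (hlim.eventually_lt_const (half_pos one_pos))
  obtain ⟨d₂, hd₂⟩ := exists_nat_ge (2 / (γ - 1))
  refine ⟨max d₁ d₂, fun d hd G _ _ ⟨s, hs, hgen⟩ => ?_⟩
  have hdk : d + 2 ≤ ⌊γ * (d : ℝ)⌋₊ := by
    refine Nat.le_floor ?_
    have hd2 : (d₂ : ℝ) ≤ d := by exact_mod_cast (le_max_right _ _).trans hd
    have := (div_le_iff₀ (by linarith)).1 (hd₂.trans hd2)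
    push_cast
    linarith
  have hbound := choose_floor_mul_two_pow_le hγ hγα d
  have hsmall := hd₁ d ((le_max_left _ _).trans hd)
  rw [← hq] at hbound
  set m := ⌊α * (d : ℝ)⌋₊
  set k := ⌊γ * (d : ℝ)⌋₊
  have hG : (0 : ℝ) < (Fintype.card G : ℝ) ^ m := by
    have : 0 < Fintype.card G := Fintype.card_pos
    positivity
  have hsub : ({g : Fin m → G | ∃ S : Finset (Fin m), #S = k ∧
      Subgroup.closure (g '' (S : Set (Fin m))) ≠ ⊤} : Finset (Fin m → G)) ⊆
      (powersetCard k univ).biUnion fun S : Finset (Fin m) =>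
        {g : Fin m → G | Subgroup.closure (g '' (S : Set (Fin m))) ≠ ⊤} := by
    intro g hg
    obtain ⟨S, hS, hne⟩ := (mem_filter.1 hg).2
    exact mem_biUnion.2 ⟨S, mem_powersetCard_univ.2 hS, mem_filter.2 ⟨mem_univ g, hne⟩⟩
  rw [Nat.card_eq_fintype_card, Fintype.card_subtype]
  calc (#{g : Fin m → G | ∃ S : Finset (Fin m), #S = k ∧
        Subgroup.closure (g '' (S : Set (Fin m))) ≠ ⊤} : ℝ)
      ≤ ∑ S ∈ powersetCard k (univ : Finset (Fin m)),
          (#{g : Fin m → G | Subgroup.closure (g '' (S : Set (Fin m))) ≠ ⊤} : ℝ) := by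
        exact_mod_cast (card_le_card hsub).trans card_biUnion_le
    _ ≤ ∑ S ∈ powersetCard k (univ : Finset (Fin m)),
          (Fintype.card G : ℝ) ^ m * (4 * (2 ^ d / 2 ^ k)) := by
        refine sum_le_sum fun S hS => ?_
        have hle := card_filter_closure_image_ne_top_le hgen S
        rw [hs, mem_powersetCard_univ.1 hS, Fintype.card_fin] at hle
        refine le_trans ?_ (hle.trans (by gcongr; exact sum_Icc_two_pow_div_pow_le hdk _))
        convert le_rfl
    _ = (Fintype.card G : ℝ) ^ m * (4 * ((m.choose k : ℕ) * (2 ^ d / 2 ^ k))) := by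
        rw [sum_const, card_powersetCard, card_univ, Fintype.card_fin, nsmul_eq_mul]
        ring
    _ < (Fintype.card G : ℝ) ^ m * (1 / 2) := by
        gcongr
        linarith
    _ = (Fintype.card G : ℝ) ^ m / 2 := by ring
end

section
/- Let N, b, r, c be natural numbers with N ≥ 1, r·N < 2^b, 2^b < (r+1)·N, and 1 ≤ c < 2^b. Set q = ⌊c·r / 2^b⌋. Then N·q < c and c − N·q < 2·N; in particular, c − N·q is a positive integer congruent to c modulo N and lying in the interval (0, 2N). -/
/-- Correctness of approximate modular reduction: if `r/2^b < 1/N < (r+1)/2^b` and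
`1 ≤ c < 2^b`, then with `q = ⌊c·r/2^b⌋` we have `N·q < c` and `c - N·q < 2N`;
in particular `c - N·q` is a positive integer congruent to `c` modulo `N`. -/
theorem approximate_mod_reduction (N b r c : ℕ) (hN : 1 ≤ N)
    (h1 : r * N < 2 ^ b) (h2 : 2 ^ b < (r + 1) * N)
    (hc1 : 1 ≤ c) (hc2 : c < 2 ^ b) :
    N * (c * r / 2 ^ b) < c ∧
      c - N * (c * r / 2 ^ b) < 2 * N ∧
      0 < c - N * (c * r / 2 ^ b) ∧
      (c - N * (c * r / 2 ^ b)) % N = c % N := by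
  have hM : 0 < 2 ^ b := by positivity
  have hlo : 2 ^ b * (c * r / 2 ^ b) ≤ c * r := Nat.mul_div_le _ _
  have hhi : c * r < 2 ^ b * (c * r / 2 ^ b + 1) := Nat.lt_mul_div_succ _ hM
  generalize 2 ^ b = M at *
  generalize c * r / M = q at *
  have hlt : N * q < c := by
    refine Nat.lt_of_mul_lt_mul_left (a := M) ?_
    calc M * (N * q) = N * (M * q) := by ring
      _ ≤ N * (c * r) := Nat.mul_le_mul_left _ hlo
      _ = c * (r * N) := by ring
      _ < c * M := Nat.mul_lt_mul_of_pos_left h1 hc1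
      _ = M * c := by ring
  have hub : c < N * q + 2 * N := by
    refine Nat.lt_of_mul_lt_mul_left (a := M) ?_
    calc M * c = c * M := by ring
      _ ≤ c * ((r + 1) * N) := Nat.mul_le_mul_left _ h2.le
      _ = (c * r + c) * N := by ring
      _ < (M * (q + 1) + M) * N := Nat.mul_lt_mul_of_pos_right (by omega) hN
      _ = M * (N * q + 2 * N) := by ring
  exact ⟨hlt, by omega, by omega, Nat.sub_mul_mod hlt.le⟩
end

section
/- Let R be a commutative ring, let a and b be invertible elements of R, and let g ∈ R be arbitrary. Define successively g₁ = g + a·b, b₁ = b − a⁻¹·g₁, g₂ = g₁ + a·b₁, b₂ = b₁ + a⁻¹·b⁻¹, h = b⁻¹ − a·b₂, and b₃ = b₂ + a⁻¹·h. Then b₁ = −a⁻¹·g, g₂ = a·b, b₂ = −a⁻¹·g + a⁻¹·b⁻¹, h = g, and b₃ = (a·b)⁻¹. Consequently, this chain of six register updates, each of which adds or subtracts a product of two other registers, transforms the tuple (a, a⁻¹, b, b⁻¹, g) into (a, a⁻¹, (a·b)⁻¹, g, a·b), which after permuting registers equals (a, a⁻¹, a·b, (a·b)⁻¹, g). -/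
/-- Algebraic correctness of the in-place quantum-quantum modular multiplication
circuit: the chain of six multiply-accumulate register updates transforms
`(a, a⁻¹, b, b⁻¹, g)` into (after permuting registers) `(a, a⁻¹, a·b, (a·b)⁻¹, g)`. -/
theorem inplace_mult_correct {R : Type*} [CommRing R] (a b : Rˣ) (g : R)
    (g₁ b₁ g₂ b₂ h b₃ : R)
    (hg₁ : g₁ = g + (a : R) * (b : R))
    (hb₁ : b₁ = (b : R) - ((a⁻¹ : Rˣ) : R) * g₁)
    (hg₂ : g₂ = g₁ + (a : R) * b₁)
    (hb₂ : b₂ = b₁ + ((a⁻¹ : Rˣ) : R) * ((b⁻¹ : Rˣ) : R))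
    (hh : h = ((b⁻¹ : Rˣ) : R) - (a : R) * b₂)
    (hb₃ : b₃ = b₂ + ((a⁻¹ : Rˣ) : R) * h) :
    b₁ = -((a⁻¹ : Rˣ) : R) * g ∧
      g₂ = (a : R) * (b : R) ∧
      b₂ = -((a⁻¹ : Rˣ) : R) * g + ((a⁻¹ : Rˣ) : R) * ((b⁻¹ : Rˣ) : R) ∧
      h = g ∧
      b₃ = (((a * b)⁻¹ : Rˣ) : R) := by
  have ha : (a : R) * ((a⁻¹ : Rˣ) : R) = 1 := a.mul_inv
  have hb₁' : b₁ = -((a⁻¹ : Rˣ) : R) * g := by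
    rw [hb₁, hg₁]
    linear_combination -(b : R) * ha
  have hb₂' : b₂ = -((a⁻¹ : Rˣ) : R) * g + ((a⁻¹ : Rˣ) : R) * ((b⁻¹ : Rˣ) : R) := by
    rw [hb₂, hb₁']
  have hh' : h = g := by
    rw [hh, hb₂']
    linear_combination (g - ((b⁻¹ : Rˣ) : R)) * ha
  refine ⟨hb₁', ?_, hb₂', hh', ?_⟩
  · rw [hg₂, hg₁, hb₁']
    linear_combination -g * ha
  · rw [hb₃, hb₂', hh', mul_inv, Units.val_mul]
    ring
end
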